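/- Let G be a minimal counterexample. Then no vertex of F has degree 1 or degree 2 in G. -/

import Mathlib

open SimpleGraph

noncomputable def edgeCount {V : Type*} (G : SimpleGraph V) : ℕ := Nat.card G.edgeSet

noncomputable def deg {V : Type*} (G : SimpleGraph V) (v : V) : ℕ := Nat.card (G.neighborSet v)

def TwoIndependent {V : Type*} (G : SimpleGraph V) (S : Set V) : Prop :=
  ∀ u ∈ S, ∀ v ∈ S, u ≠ v → ¬ G.Adj u v ∧ ∀ w, ¬ (G.Adj u w ∧ G.Adj w v)

def IsIFPartition {V : Type*} (G : SimpleGraph V) (A B : Set V) : Prop :=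
  A ∪ B = Set.univ ∧ Disjoint A B ∧ TwoIndependent G A ∧ (G.induce B).IsAcyclic

def IsAssignment {V : Type*} (I F U : Set V) : Prop :=
  I ∪ F ∪ U = Set.univ ∧ Disjoint I F ∧ Disjoint I U ∧ Disjoint F U

noncomputable def rho {V : Type*} (G : SimpleGraph V) (I F U : Set V) (H : G.Subgraph) : ℤ :=
  (H.verts ∩ I).ncard + 4 * (H.verts ∩ F).ncard + 5 * (H.verts ∩ U).ncard
    - 4 * Nat.card H.edgeSet

noncomputable def rhoSet {V : Type*} (G : SimpleGraph V) (I F U : Set V) (S : Set V) : ℤ :=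
  (S ∩ I).ncard + 4 * (S ∩ F).ncard + 5 * (S ∩ U).ncard - 4 * edgeCount (G.induce S)

def IsCounterexample {V : Type*} [Fintype V] (G : SimpleGraph V) (I F U : Set V) : Prop :=
  IsAssignment I F U ∧
  (∀ H : G.Subgraph, H.verts.Nonempty → 0 < rho G I F U H) ∧
  ¬ ∃ A B : Set V, IsIFPartition G A B ∧ I ⊆ A ∧ F ⊆ B

def IsMinCounterexample {V : Type*} [Fintype V] (G : SimpleGraph V) (I F U : Set V) : Prop :=
  IsCounterexample G I F U ∧
  ∀ (n : ℕ) (G' : SimpleGraph (Fin n)) (I' F' U' : Set (Fin n)),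
    IsCounterexample G' I' F' U' →
    Fintype.card V + edgeCount G ≤ n + edgeCount G'

def IsThread {V : Type*} (G : SimpleGraph V) (I F U : Set V) (p : List V) : Prop :=
  p ≠ [] ∧ p.Nodup ∧ p.Chain' G.Adj ∧ (∀ v ∈ p, v ∈ U ∧ deg G v = 2) ∧
  (∀ w, w ∉ p → (∃ a ∈ p, G.Adj a w) → 3 ≤ deg G w ∨ w ∈ I ∪ F)

def BordersThread {V : Type*} (G : SimpleGraph V) (p : List V) (w : V) : Prop :=
  w ∉ p ∧ ∃ a ∈ p, G.Adj a w

def IsStarForest {V : Type*} (H : SimpleGraph V) : Prop :=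
  H.IsAcyclic ∧ ∀ a b c d : V, H.Adj a b → H.Adj b c → H.Adj c d → a = c ∨ b = d

def IsStarColoring {V : Type*} {k : ℕ} (G : SimpleGraph V) (c : V → Fin k) : Prop :=
  (∀ u v, G.Adj u v → c u ≠ c v) ∧
  ∀ i j : Fin k, IsStarForest (G.induce {v | c v = i ∨ c v = j})

def StarColorable {V : Type*} (G : SimpleGraph V) (k : ℕ) : Prop :=
  ∃ c : V → Fin k, IsStarColoring G c

def MadLt {V : Type*} (G : SimpleGraph V) (q : ℚ) : Prop :=
  ∀ H : G.Subgraph, H.verts.Nonempty →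
    (2 * (Nat.card H.edgeSet : ℚ)) / (H.verts.ncard : ℚ) < q

section Aux
open Classical Finset

lemma aux_iso_not_reachable {X : Type*} {K : SimpleGraph X} {v u : X} (hvu : v ≠ u)
    (hiso : ∀ x, ¬ K.Adj v x) : ¬ K.Reachable v u := by
  rintro ⟨p⟩
  cases p with
  | nil => exact hvu rfl
  | cons h _ => exact hiso _ h

lemma aux_acyc1 {X : Type*} {K K' : SimpleGraph X} {v u : X} (hvu : v ≠ u)
    (hK : K'.IsAcyclic) (hiso : ∀ x, ¬ K'.Adj v x)
    (hle : ∀ a b, K.Adj a b → K'.Adj a b ∨ (a = v ∧ b = u) ∨ (a = u ∧ b = v)) :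
    K.IsAcyclic := by
  refine IsAcyclic.anti ?_ (hK.sup_edge_of_not_reachable (aux_iso_not_reachable hvu hiso))
  intro a b hab
  have := hab.ne
  have := hle a b hab
  rw [sup_adj, edge_adj]
  tauto

lemma aux_acyc2 {X : Type*} {K K0 : SimpleGraph X} {v u w : X} (hvu : v ≠ u) (hvw : v ≠ w)
    (huw : u ≠ w) (hna : ¬ K0.Adj u w)
    (hK : (K0 ⊔ edge u w).IsAcyclic) (hiso : ∀ x, ¬ K0.Adj v x)
    (hle : ∀ a b, K.Adj a b → K0.Adj a b ∨ (a = v ∧ b = u) ∨ (a = u ∧ b = v) ∨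
      (a = v ∧ b = w) ∨ (a = w ∧ b = v)) :
    K.IsAcyclic := by
  rw [isAcyclic_sup_fromEdgeSet_iff] at hK
  obtain ⟨hK0, hr⟩ := hK
  have hnr : ¬ K0.Reachable u w := by tauto
  have h1 : (K0 ⊔ edge v u).IsAcyclic :=
    hK0.sup_edge_of_not_reachable (aux_iso_not_reachable hvu hiso)
  have key : ∀ a b, (K0 ⊔ edge v u).Reachable a b →
      K0.Reachable (if a = v then u else a) (if b = v then u else b) := by
    rintro a b ⟨p⟩
    induction p with
    | nil => exact Reachable.refl _
    | @cons a b c h _ ih =>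
      refine Reachable.trans ?_ ih
      rw [sup_adj, edge_adj] at h
      rcases h with h | ⟨⟨rfl, rfl⟩ | ⟨rfl, rfl⟩, _⟩
      · have ha : a ≠ v := by rintro rfl; exact hiso _ h
        have hb : b ≠ v := by rintro rfl; exact hiso _ h.symm
        simpa [ha, hb] using h.reachable
      · simp
      · simp
  have h2 : ¬ (K0 ⊔ edge v u).Reachable v w := by
    intro h
    have := key _ _ h
    simp [hvw.symm] at this
    exact hnr this
  refine IsAcyclic.anti ?_ (h1.sup_edge_of_not_reachable h2)
  intro a b hab
  have := hab.ne
  have := hle a b hab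
  rw [sup_adj, edge_adj, sup_adj, edge_adj]
  tauto

/-- adjacency indicator -/
noncomputable def adjI {V : Type*} (G : SimpleGraph V) (a b : V) : ℤ := if G.Adj a b then 1 else 0

/-- number of ordered adjacent pairs in `S` -/
noncomputable def dsum {V : Type*} (G : SimpleGraph V) (S : Finset V) : ℤ :=
  ∑ a ∈ S, ∑ b ∈ S, adjI G a b

noncomputable def wt {V : Type*} (I F : Set V) (x : V) : ℤ :=
  if x ∈ I then 1 else if x ∈ F then 4 else 5

noncomputable def pot {V : Type*} (G : SimpleGraph V) (I F : Set V) (S : Finset V) : ℤ :=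
  ∑ a ∈ S, wt I F a - 2 * dsum G S

lemma adjI_nonneg {V : Type*} (G : SimpleGraph V) (a b : V) : 0 ≤ adjI G a b := by
  unfold adjI; split_ifs <;> simp

lemma two_edges {V : Type*} [Fintype V] (G : SimpleGraph V) :
    2 * (Nat.card G.edgeSet : ℤ) = dsum G univ := by
  have h := G.sum_degrees_eq_twice_card_edges
  have h2 : Nat.card G.edgeSet = #G.edgeFinset := by
    rw [Nat.card_eq_fintype_card, edgeFinset_card]
  rw [h2]
  have h3 : ((∑ v, G.degree v : ℕ) : ℤ) = dsum G univ := by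
    unfold dsum
    push_cast
    refine sum_congr rfl fun a _ => ?_
    unfold adjI
    rw [← card_neighborFinset_eq_degree, neighborFinset_eq_filter]
    simp
  rw [← h3, h]; push_cast; ring

lemma rho_eq {V : Type*} [Fintype V] (G : SimpleGraph V) (I F U : Set V)
    (hA : IsAssignment I F U) (H : G.Subgraph) :
    rho G I F U H = ∑ a ∈ H.verts.toFinset, wt I F a - 2 * dsum H.spanningCoe univ := by
  have h1 := two_edges H.spanningCoe
  rw [Subgraph.edgeSet_spanningCoe] at h1
  obtain ⟨hu, h12, h13, h23⟩ := hA
  have hc : ∀ Z : Set V, ((H.verts ∩ Z).ncard : ℤ) =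
      ∑ a ∈ H.verts.toFinset, if a ∈ Z then 1 else 0 := by
    intro Z
    rw [Set.ncard_eq_toFinset_card', Finset.sum_boole]
    congr 2
    ext; simp
  unfold rho
  rw [hc, hc, hc, ← h1, mul_sum, mul_sum, ← sum_add_distrib, ← sum_add_distrib]
  have : ∀ a, ((if a ∈ I then 1 else 0) + 4 * (if a ∈ F then 1 else 0) +
      5 * (if a ∈ U then 1 else 0) : ℤ) = wt I F a := by
    intro a
    have ha : a ∈ I ∪ F ∪ U := hu ▸ Set.mem_univ a
    have h12' : a ∈ I → a ∉ F := fun h => Set.disjoint_left.1 h12 h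
    have h13' : a ∈ I → a ∉ U := fun h => Set.disjoint_left.1 h13 h
    have h23' : a ∈ F → a ∉ U := fun h => Set.disjoint_left.1 h23 h
    simp only [Set.mem_union] at ha
    unfold wt
    by_cases hI : a ∈ I <;> by_cases hF : a ∈ F <;> by_cases hU : a ∈ U <;> simp_all
  simp only [this]
  ring

lemma pos_iff {V : Type*} [Fintype V] (G : SimpleGraph V) (I F U : Set V)
    (hA : IsAssignment I F U) :
    (∀ H : G.Subgraph, H.verts.Nonempty → 0 < rho G I F U H) ↔
      ∀ S : Finset V, S.Nonempty → 0 < pot G I F S := by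
  have hS : ∀ S : Finset V, dsum G S =
      ∑ a, ∑ b, if a ∈ S ∧ b ∈ S then adjI G a b else 0 := by
    intro S
    unfold dsum
    simp only [ite_and, sum_ite_irrel, sum_const_zero, sum_ite_mem, univ_inter]
  constructor
  · intro h S hne
    have := h ((⊤ : G.Subgraph).induce S) (by simpa using hne)
    rw [rho_eq G I F U hA] at this
    unfold pot
    rw [hS]
    convert this using 2
    · simp
    · congr 1
      unfold dsum adjI
      refine sum_congr rfl fun a _ => sum_congr rfl fun b _ => ?_
      simp [ite_and]
  · intro h H hne
    have := h H.verts.toFinset (by simpa using hne)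
    rw [rho_eq G I F U hA]
    unfold pot at this
    rw [hS] at this
    have h3 : dsum H.spanningCoe univ ≤
        ∑ a, ∑ b, if a ∈ H.verts.toFinset ∧ b ∈ H.verts.toFinset then adjI G a b else 0 := by
      unfold dsum
      refine sum_le_sum fun a _ => sum_le_sum fun b _ => ?_
      by_cases hab : H.Adj a b
      · have := hab.adj_sub
        have := H.edge_vert hab
        have := H.edge_vert hab.symm
        simp [adjI, *]
      · simp only [adjI, Subgraph.spanningCoe_adj, hab, if_false]
        split_ifs <;> simp
    linarith

lemma dsum_map {V W : Type*} (G : SimpleGraph V) (e : W ≃ V) (S : Finset W) :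
    dsum (G.comap e) S = dsum G (S.map e.toEmbedding) := by
  simp only [dsum, sum_map]
  rfl

lemma min_use {V : Type*} [Fintype V] {G : SimpleGraph V} {I F U : Set V}
    (hmin : IsMinCounterexample G I F U) (G' : SimpleGraph V) (I' F' : Set V)
    (hd : Disjoint I' F') (hlt : dsum G' univ < dsum G univ)
    (hpos : ∀ S : Finset V, S.Nonempty → 0 < pot G' I' F' S) :
    ∃ A B : Set V, IsIFPartition G' A B ∧ I' ⊆ A ∧ F' ⊆ B := by
  by_contra hno
  have e : Fin (Fintype.card V) ≃ V := (Fintype.equivFin V).symm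
  have hA : IsAssignment (e ⁻¹' I') (e ⁻¹' F') (e ⁻¹' (I' ∪ F')ᶜ) := by
    refine ⟨?_, ?_, ?_, ?_⟩
    · ext x; simp; tauto
    · exact hd.preimage _
    · rw [Set.disjoint_left]; intro x; simp; tauto
    · rw [Set.disjoint_left]; intro x; simp; tauto
  have := hmin.2 _ (G'.comap e) (e ⁻¹' I') (e ⁻¹' F') (e ⁻¹' (I' ∪ F')ᶜ) ⟨hA, ?_, ?_⟩
  · have h1 := two_edges G
    have h2 := two_edges (G'.comap e)
    rw [dsum_map] at h2
    rw [Finset.map_univ_equiv] at h2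
    unfold edgeCount at this
    omega
  · rw [pos_iff _ _ _ _ hA]
    intro S hS
    have := hpos (S.map e.toEmbedding) (by simpa using hS)
    unfold pot at this ⊢
    rw [dsum_map]
    simpa [wt] using this
  · rintro ⟨A, B, ⟨hu, hdj, h2, hac⟩, hI, hF⟩
    apply hno
    refine ⟨e.symm ⁻¹' A, e.symm ⁻¹' B, ⟨?_, hdj.preimage _, ?_, ?_⟩, ?_, ?_⟩
    · rw [← Set.preimage_union, hu, Set.preimage_univ]
    · intro a ha b hb hab
      have := h2 _ ha _ hb (by simpa using hab)
      refine ⟨by simpa using this.1, fun w => ?_⟩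
      simpa using this.2 (e.symm w)
    · refine hac.comap (⟨fun x => ⟨e.symm x.1, x.2⟩, ?_⟩) ?_
      · intro a b hab
        simpa using hab
      · intro a b hab
        have h := congrArg Subtype.val hab
        exact Subtype.ext (e.symm.injective h)
    · intro x hx
      exact hI (by simpa using hx)
    · intro x hx
      exact hF (by simpa using hx)

/-- edge indicator -/
noncomputable def dl {V : Type*} (x y a b : V) : ℤ :=
  (if a = x ∧ b = y then 1 else 0) + (if a = y ∧ b = x then 1 else 0)

lemma dl_sum {V : Type*} (x y : V) (S : Finset V) :
    ∑ a ∈ S, ∑ b ∈ S, dl x y a b = if x ∈ S ∧ y ∈ S then 2 else 0 := by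
  simp only [dl, sum_add_distrib, ite_and, sum_ite_eq', Finset.sum_ite_irrel, sum_const_zero]
  by_cases h1 : x ∈ S <;> by_cases h2 : y ∈ S <;> simp [h1, h2]

lemma dsum_del {V : Type*} (G : SimpleGraph V) {x y : V} (h : G.Adj x y) (S : Finset V) :
    dsum (G \ edge x y) S = dsum G S - if x ∈ S ∧ y ∈ S then 2 else 0 := by
  rw [← dl_sum]
  unfold dsum
  simp only [← sum_sub_distrib]
  refine sum_congr rfl fun a _ => sum_congr rfl fun b _ => ?_
  have := h.ne
  have := h.symm
  simp only [adjI, dl, sdiff_adj, edge_adj]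
  grind

lemma dsum_add {V : Type*} (G : SimpleGraph V) {x y : V} (hne : x ≠ y) (h : ¬ G.Adj x y)
    (S : Finset V) :
    dsum (G ⊔ edge x y) S = dsum G S + if x ∈ S ∧ y ∈ S then 2 else 0 := by
  rw [← dl_sum]
  unfold dsum
  simp only [← sum_add_distrib]
  refine sum_congr rfl fun a _ => sum_congr rfl fun b _ => ?_
  have : ¬ G.Adj y x := fun h' => h h'.symm
  simp only [adjI, dl, sup_adj, edge_adj]
  grind

lemma pot_insert {V : Type*} (G : SimpleGraph V) (I F : Set V) {v : V} {S : Finset V}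
    (hv : v ∉ S) : pot G I F (insert v S) = pot G I F S + wt I F v - 4 * ∑ b ∈ S, adjI G v b := by
  unfold pot dsum
  rw [sum_insert hv, sum_insert hv, sum_insert hv]
  have h0 : adjI G v v = 0 := by simp [adjI]
  have h1 : ∑ a ∈ S, ∑ b ∈ insert v S, adjI G a b =
      ∑ a ∈ S, adjI G v a + ∑ a ∈ S, ∑ b ∈ S, adjI G a b := by
    rw [← sum_add_distrib]
    refine sum_congr rfl fun a _ => ?_
    rw [sum_insert hv]
    simp [adjI, G.adj_comm]
  rw [h1, h0]; ring

lemma pot_union {V : Type*} (G : SimpleGraph V) (I F : Set V) {u w : V} {S T : Finset V}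
    (h : G.Adj u w) (hu : u ∈ S) (hw : w ∈ T) (hw' : w ∉ S) (hu' : u ∉ T) :
    pot G I F (S ∪ T) + pot G I F (S ∩ T) + 4 ≤ pot G I F S + pot G I F T := by
  have h1 : ∑ a ∈ S ∪ T, wt I F a + ∑ a ∈ S ∩ T, wt I F a =
    ∑ a ∈ S, wt I F a + ∑ a ∈ T, wt I F a := sum_union_inter
  have hS : ∀ R : Finset V, R ⊆ S ∪ T → dsum G R =
      ∑ a ∈ S ∪ T, ∑ b ∈ S ∪ T, if a ∈ R ∧ b ∈ R then adjI G a b else 0 := by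
    intro R hR
    unfold dsum
    have := Finset.inter_eq_right.2 hR
    simp only [ite_and, sum_ite_irrel, sum_const_zero, sum_ite_mem, this]
  have h2 : dsum G S + dsum G T + 2 ≤ dsum G (S ∪ T) + dsum G (S ∩ T) := by
    have h3 := dl_sum u w (S ∪ T)
    rw [if_pos (by simp [hu, hw])] at h3
    rw [← h3, hS S subset_union_left, hS T subset_union_right, hS (S ∪ T) subset_rfl,
      hS (S ∩ T) (inter_subset_left.trans subset_union_left)]
    simp only [← sum_add_distrib]
    refine sum_le_sum fun a _ => sum_le_sum fun b _ => ?_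
    have := h.ne
    have := h.symm
    simp only [adjI, dl, mem_union, mem_inter]
    grind
  unfold pot
  linarith

lemma deg_one_case {V : Type*} [Fintype V] {G : SimpleGraph V}
    {I F U : Set V} (hmin : IsMinCounterexample G I F U) {v w : V} (hv : v ∈ F)
    (hN : ∀ x, G.Adj v x ↔ x = w) : False := by
  have hA := hmin.1.1
  have hpos := (pos_iff G I F U hA).1 hmin.1.2.1
  have hvw : G.Adj v w := (hN w).2 rfl
  have hne := hvw.ne
  obtain ⟨A, B, ⟨hu, hdj, h2, hac⟩, hI, hF⟩ := min_use hmin (G \ edge v w) I F hA.2.1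
    (by rw [dsum_del G hvw]; simp) (by
      intro S hS
      have := hpos S hS
      unfold pot at this ⊢
      rw [dsum_del G hvw]
      split_ifs <;> linarith)
  have hvB := hF hv
  have hvA : v ∉ A := fun h => Set.disjoint_left.1 hdj h hvB
  have hadj : ∀ a b, (G \ edge v w).Adj a b ↔ G.Adj a b ∧ a ≠ v ∧ b ≠ v := by
    intro a b
    rw [sdiff_adj, edge_adj]
    have h1 := hN b
    have h2 := hN a
    have h3 := G.adj_comm a b
    grind
  refine hmin.1.2.2 ⟨A, B, ⟨hu, hdj, ?_, ?_⟩, hI, hF⟩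
  · intro a ha b hb hab
    have hav : a ≠ v := by rintro rfl; exact hvA ha
    have hbv : b ≠ v := by rintro rfl; exact hvA hb
    obtain ⟨h3, h4⟩ := h2 a ha b hb hab
    refine ⟨fun h => h3 ((hadj _ _).2 ⟨h, hav, hbv⟩), ?_⟩
    rintro x ⟨hx1, hx2⟩
    by_cases hxv : x = v
    · subst hxv
      exact hab (((hN a).1 hx1.symm).trans ((hN b).1 hx2).symm)
    · exact h4 x ⟨(hadj _ _).2 ⟨hx1, hav, hxv⟩, (hadj _ _).2 ⟨hx2, hxv, hbv⟩⟩
  · by_cases hwB : w ∈ B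
    · refine aux_acyc1 (v := ⟨v, hvB⟩) (u := ⟨w, hwB⟩) (by simpa using hne) hac ?_ ?_
      · rintro ⟨x, hx⟩ h
        exact ((hadj _ _).1 h).2.1 rfl
      · rintro ⟨a, ha⟩ ⟨b, hb⟩ h
        have h' : G.Adj a b := h
        simp only [comap_adj, Function.Embedding.subtype_apply, hadj, Subtype.mk.injEq]
        have h1 := hN b
        have h2 := hN a
        have h3 := G.adj_comm a b
        grind
    · refine IsAcyclic.anti ?_ hac
      rintro ⟨a, ha⟩ ⟨b, hb⟩ h
      have h' : G.Adj a b := h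
      simp only [comap_adj, Function.Embedding.subtype_apply, hadj]
      have h1 := hN b
      have h2 := hN a
      have h3 := G.adj_comm a b
      grind

lemma deg_two_nonadj {V : Type*} [Fintype V] {G : SimpleGraph V}
    {I F U : Set V} (hmin : IsMinCounterexample G I F U) {v u w : V} (hv : v ∈ F)
    (huw : u ≠ w) (hna : ¬ G.Adj u w)
    (hN : ∀ x, G.Adj v x ↔ x = u ∨ x = w) : False := by
  have hA := hmin.1.1
  have hpos := (pos_iff G I F U hA).1 hmin.1.2.1
  have hvu : G.Adj v u := (hN u).2 (Or.inl rfl)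
  have hvw : G.Adj v w := (hN w).2 (Or.inr rfl)
  have hne := hvw.ne
  have hne' := hvu.ne
  have hwv : wt I F v = 4 := by
    have : v ∉ I := fun h => Set.disjoint_left.1 hA.2.1 h hv
    simp [wt, this, hv]
  have hds : ∀ S, dsum ((G \ edge v u) \ edge v w ⊔ edge u w) S = dsum G S
      - (if v ∈ S ∧ u ∈ S then 2 else 0) - (if v ∈ S ∧ w ∈ S then 2 else 0)
      + (if u ∈ S ∧ w ∈ S then 2 else 0) := by
    intro S
    rw [dsum_add _ huw, dsum_del, dsum_del _ hvu]
    · rw [sdiff_adj, edge_adj]; grind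
    · rw [sdiff_adj, sdiff_adj]; tauto
  obtain ⟨A, B, ⟨hu, hdj, h2, hac⟩, hI, hF⟩ :=
    min_use hmin ((G \ edge v u) \ edge v w ⊔ edge u w) I F hA.2.1
    (by rw [hds]; simp) (by
      intro S hS
      have h0 := hpos S hS
      have h1 : pot G I F S + (if v ∈ S ∧ u ∈ S then 4 else 0) + (if v ∈ S ∧ w ∈ S then 4 else 0)
        - (if u ∈ S ∧ w ∈ S then 4 else 0) =
          pot ((G \ edge v u) \ edge v w ⊔ edge u w) I F S := by
        unfold pot
        rw [hds]
        split_ifs <;> ring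
      rw [← h1]
      by_cases hvS : v ∈ S
      · simp only [hvS, true_and]
        split_ifs <;> first | linarith | (exfalso; tauto)
      by_cases huS : u ∈ S ∧ w ∈ S
      · have h3 := hpos (insert v S) (Finset.insert_nonempty _ _)
        rw [pot_insert G I F hvS, hwv] at h3
        have h4 : ∑ b ∈ ({u, w} : Finset V), adjI G v b ≤ ∑ b ∈ S, adjI G v b :=
          Finset.sum_le_sum_of_subset_of_nonneg (by
            intro x; simp only [Finset.mem_insert, Finset.mem_singleton]
            rintro (rfl | rfl); exacts [huS.1, huS.2]) (fun _ _ _ => adjI_nonneg _ _ _)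
        rw [Finset.sum_pair huw] at h4
        simp only [adjI, hvu, hvw, if_true] at h4
        simp only [hvS, huS, false_and, and_self, if_true, if_false]
        unfold adjI at h3
        linarith
      · simp only [hvS, huS, false_and, if_false]
        linarith)
  have hvB := hF hv
  have hvA : v ∉ A := fun h => Set.disjoint_left.1 hdj h hvB
  have hadj : ∀ a b, ((G \ edge v u) \ edge v w ⊔ edge u w).Adj a b ↔
      (G.Adj a b ∧ a ≠ v ∧ b ≠ v) ∨ (a = u ∧ b = w) ∨ (a = w ∧ b = u) := by
    intro a b
    rw [sup_adj, sdiff_adj, sdiff_adj, edge_adj, edge_adj, edge_adj]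
    have h1 := hN b
    have h2 := hN a
    have h3 := G.adj_comm a b
    grind
  have hnuw : ¬ (u ∈ A ∧ w ∈ A) := by
    rintro ⟨h3, h4⟩
    exact (h2 u h3 w h4 huw).1 ((hadj _ _).2 (by simp))
  refine hmin.1.2.2 ⟨A, B, ⟨hu, hdj, ?_, ?_⟩, hI, hF⟩
  · intro a ha b hb hab
    have hav : a ≠ v := by rintro rfl; exact hvA ha
    have hbv : b ≠ v := by rintro rfl; exact hvA hb
    obtain ⟨h3, h4⟩ := h2 a ha b hb hab
    refine ⟨fun h => h3 ((hadj _ _).2 (Or.inl ⟨h, hav, hbv⟩)), ?_⟩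
    rintro x ⟨hx1, hx2⟩
    by_cases hxv : x = v
    · subst hxv
      have h5 := (hN a).1 hx1.symm
      have h6 := (hN b).1 hx2
      grind
    · exact h4 x ⟨(hadj _ _).2 (Or.inl ⟨hx1, hav, hxv⟩), (hadj _ _).2 (Or.inl ⟨hx2, hxv, hbv⟩)⟩
  · -- the graph with `v` isolated
    let G0 : SimpleGraph V := (G \ edge v u) \ edge v w
    have hG0 : ∀ a b, G0.Adj a b ↔ (G.Adj a b ∧ a ≠ v ∧ b ≠ v) := by
      intro a b
      show ((G \ edge v u) \ edge v w).Adj a b ↔ _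
      rw [sdiff_adj, sdiff_adj, edge_adj, edge_adj]
      have h1 := hN b
      have h2 := hN a
      have h3 := G.adj_comm a b
      grind
    have hac0 : (G0.induce B).IsAcyclic := by
      refine IsAcyclic.anti ?_ hac
      rintro ⟨a, ha⟩ ⟨b, hb⟩ h
      exact Or.inl h
    have hiso : ∀ x, ¬ (G0.induce B).Adj ⟨v, hvB⟩ x := by
      rintro ⟨x, hx⟩ h
      exact ((hG0 _ _).1 h).2.1 rfl
    have one : ∀ (y z : V) (hyB : y ∈ B), z ∉ B → v ≠ y → (∀ x, G.Adj v x ↔ x = y ∨ x = z) →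
        (G.induce B).IsAcyclic := by
      intro y z hyB hzB hvy hN'
      refine aux_acyc1 (v := ⟨v, hvB⟩) (u := ⟨y, hyB⟩) (by simpa using hvy) hac0 hiso ?_
      rintro ⟨a, ha⟩ ⟨b, hb⟩ h
      have h' : G.Adj a b := h
      simp only [comap_adj, Function.Embedding.subtype_apply, hG0, Subtype.mk.injEq]
      have h1 := hN' b
      have h2 := hN' a
      have h3 := G.adj_comm a b
      grind
    by_cases huB : u ∈ B
    · by_cases hwB : w ∈ B
      · refine aux_acyc2 (K0 := G0.induce B) (v := ⟨v, hvB⟩) (u := ⟨u, huB⟩) (w := ⟨w, hwB⟩)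
          (by simpa using hne') (by simpa using hne) (by simpa using huw) ?_ ?_ hiso ?_
        · intro h; exact hna ((hG0 _ _).1 h).1
        · refine IsAcyclic.anti ?_ hac
          rintro ⟨a, ha⟩ ⟨b, hb⟩ h
          rw [sup_adj, edge_adj] at h
          simp only [comap_adj, Function.Embedding.subtype_apply, hG0, Subtype.mk.injEq] at h
          simp only [comap_adj, Function.Embedding.subtype_apply, hadj]
          tauto
        · rintro ⟨a, ha⟩ ⟨b, hb⟩ h
          have h' : G.Adj a b := h
          simp only [comap_adj, Function.Embedding.subtype_apply, hG0, Subtype.mk.injEq]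
          have h1 := hN b
          have h2 := hN a
          have h3 := G.adj_comm a b
          grind
      · exact one u w huB hwB hne' hN
    · have huA : u ∈ A ∪ B := hu ▸ Set.mem_univ u
      have hwA : w ∈ A ∪ B := hu ▸ Set.mem_univ w
      have hwB : w ∈ B := by
        rcases huA with h | h
        · rcases hwA with h' | h'
          · exact absurd ⟨h, h'⟩ hnuw
          · exact h'
        · exact absurd h huB
      exact one w u hwB huB hne (fun x => by rw [hN x, or_comm])

/-- In the triangle case, moving an unassigned neighbour to `I` must create a bad set. -/
lemma triangle_bad {V : Type*} [Fintype V] {G : SimpleGraph V}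
    {I F U : Set V} (hmin : IsMinCounterexample G I F U) {v u w : V} (hv : v ∈ F)
    (huw : G.Adj u w) (hN : ∀ x, G.Adj v x ↔ x = u ∨ x = w) (hwu : wt I F u = 5) :
    ∃ S : Finset V, u ∈ S ∧ v ∉ S ∧ pot G I F S ≤ 4 := by
  by_contra hbad
  push Not at hbad
  have hA := hmin.1.1
  have hpos := (pos_iff G I F U hA).1 hmin.1.2.1
  have hvu : G.Adj v u := (hN u).2 (Or.inl rfl)
  have hvw : G.Adj v w := (hN w).2 (Or.inr rfl)
  have huIF : u ∉ I ∧ u ∉ F := by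
    unfold wt at hwu
    constructor <;> intro h <;> simp [h] at hwu
    split_ifs at hwu <;> simp at hwu
  obtain ⟨A, B, ⟨hu, hdj, h2, hac⟩, hI, hF⟩ := min_use hmin (G \ edge v u) (insert u I) F
    (by rw [Set.disjoint_insert_left]; exact ⟨huIF.2, hA.2.1⟩)
    (by rw [dsum_del G hvu]; simp) (by
      intro S hS
      have h0 := hpos S hS
      have hw : ∑ a ∈ S, wt (insert u I) F a =
          ∑ a ∈ S, wt I F a - if u ∈ S then 4 else 0 := by
        have : ∀ a, wt (insert u I) F a = wt I F a - if a = u then 4 else 0 := by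
          intro a
          by_cases h : a = u
          · subst h; rw [hwu]; simp [wt]
          · simp [wt, h]
        simp only [this, Finset.sum_sub_distrib, Finset.sum_ite_eq']
      have hb := hbad S
      unfold pot at h0 hb ⊢
      rw [dsum_del G hvu, hw]
      by_cases h3 : u ∈ S <;> by_cases h4 : v ∈ S <;> simp only [h3, h4, and_self, and_false,
        and_true, true_and, false_and, if_true, if_false]
      · linarith
      · have := hb h3 h4; linarith
      · linarith
      · linarith)
  have hvB := hF hv
  have hvA : v ∉ A := fun h => Set.disjoint_left.1 hdj h hvB
  have huA : u ∈ A := hI (Set.mem_insert _ _)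
  have huB : u ∉ B := fun h => Set.disjoint_left.1 hdj huA h
  have hadj : ∀ a b, (G \ edge v u).Adj a b ↔
      G.Adj a b ∧ ¬ (a = v ∧ b = u) ∧ ¬ (a = u ∧ b = v) := by
    intro a b
    rw [sdiff_adj, edge_adj]
    have := hvu.ne
    grind
  have hwA : w ∉ A := by
    intro h
    refine (h2 u huA w h huw.ne).1 ((hadj _ _).2 ⟨huw, ?_, ?_⟩)
    · rintro ⟨rfl, _⟩; exact hvA huA
    · rintro ⟨_, rfl⟩; exact hvA h
  refine hmin.1.2.2 ⟨A, B, ⟨hu, hdj, ?_, ?_⟩, (Set.subset_insert _ _).trans hI, hF⟩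
  · intro a ha b hb hab
    have hav : a ≠ v := by rintro rfl; exact hvA ha
    have hbv : b ≠ v := by rintro rfl; exact hvA hb
    obtain ⟨h3, h4⟩ := h2 a ha b hb hab
    refine ⟨fun h => h3 ((hadj _ _).2 ⟨h, by tauto, by tauto⟩), ?_⟩
    rintro x ⟨hx1, hx2⟩
    by_cases hxv : x = v
    · subst hxv
      have h5 := (hN a).1 hx1.symm
      have h6 := (hN b).1 hx2
      grind
    · exact h4 x ⟨(hadj _ _).2 ⟨hx1, by tauto, by tauto⟩, (hadj _ _).2 ⟨hx2, by tauto, by tauto⟩⟩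
  · refine IsAcyclic.anti ?_ hac
    rintro ⟨a, ha⟩ ⟨b, hb⟩ h
    have h' : G.Adj a b := h
    simp only [comap_adj, Function.Embedding.subtype_apply, hadj]
    refine ⟨h', ?_, ?_⟩
    · rintro ⟨_, rfl⟩; exact huB hb
    · rintro ⟨rfl, _⟩; exact huB ha

lemma wt_cases {V : Type*} (I F : Set V) (x : V) : wt I F x ≤ 4 ∨ wt I F x = 5 := by
  unfold wt; split_ifs <;> simp

lemma deg_two_adj {V : Type*} [Fintype V] {G : SimpleGraph V}
    {I F U : Set V} (hmin : IsMinCounterexample G I F U) {v u w : V} (hv : v ∈ F)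
    (huw : G.Adj u w) (hN : ∀ x, G.Adj v x ↔ x = u ∨ x = w) (hwu : wt I F u = 5) : False := by
  have hA := hmin.1.1
  have hpos := (pos_iff G I F U hA).1 hmin.1.2.1
  have hvu : G.Adj v u := (hN u).2 (Or.inl rfl)
  have hvw : G.Adj v w := (hN w).2 (Or.inr rfl)
  have hwv : wt I F v = 4 := by
    have : v ∉ I := fun h => Set.disjoint_left.1 hA.2.1 h hv
    simp [wt, this, hv]
  have both : ∀ S : Finset V, u ∈ S → w ∈ S → v ∉ S → 4 < pot G I F S := by
    intro S huS hwS hvS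
    have h3 := hpos (insert v S) (Finset.insert_nonempty _ _)
    rw [pot_insert G I F hvS, hwv] at h3
    have h4 : ∑ b ∈ ({u, w} : Finset V), adjI G v b ≤ ∑ b ∈ S, adjI G v b :=
      Finset.sum_le_sum_of_subset_of_nonneg (by
        intro x; simp only [Finset.mem_insert, Finset.mem_singleton]
        rintro (rfl | rfl) <;> assumption) (fun _ _ _ => adjI_nonneg _ _ _)
    rw [Finset.sum_pair huw.ne] at h4
    have h5 : adjI G v u = 1 := by simp [adjI, hvu]
    have h6 : adjI G v w = 1 := by simp [adjI, hvw]
    linarith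
  obtain ⟨S, huS, hvS, hSp⟩ := triangle_bad hmin hv huw hN hwu
  have hwS : w ∉ S := fun h => by linarith [both S huS h hvS]
  have hww : wt I F w = 5 := by
    rcases wt_cases I F w with h | h
    · exfalso
      have h3 := both (insert w S) (by simp [huS]) (by simp) (by
        simp only [Finset.mem_insert, not_or]; exact ⟨hvw.ne, hvS⟩)
      rw [pot_insert G I F hwS] at h3
      have h4 : adjI G w u ≤ ∑ b ∈ S, adjI G w b :=
        Finset.single_le_sum (f := fun b => adjI G w b) (fun _ _ => adjI_nonneg _ _ _) huS
      have h5 : adjI G w u = 1 := by simp [adjI, huw.symm]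
      linarith
    · exact h
  obtain ⟨T, hwT, hvT, hTp⟩ := triangle_bad hmin hv huw.symm
    (fun x => by rw [hN x, or_comm]) hww
  have huT : u ∉ T := fun h => by linarith [both T h hwT hvT]
  have h1 := pot_union G I F huw huS hwT hwS huT
  have h2 := both (S ∪ T) (by simp [huS]) (by simp [hwT]) (by simp [hvS, hvT])
  have h3 : 0 ≤ pot G I F (S ∩ T) := by
    rcases (S ∩ T).eq_empty_or_nonempty with h | h
    · rw [h]; simp [pot, dsum]
    · exact (hpos _ h).le
  linarith

end Aux

/-- In a minimal counterexample, `F` contains neither a 1-vertex nor a 2-vertex. -/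
theorem no_low_degree_in_F {V : Type*} [Fintype V] (G : SimpleGraph V)
    (I F U : Set V) (hmin : IsMinCounterexample G I F U) :
    ∀ v ∈ F, deg G v ≠ 1 ∧ deg G v ≠ 2 := by
  intro v hv
  constructor
  · intro h
    unfold deg at h
    rw [Nat.card_coe_set_eq, Set.ncard_eq_one] at h
    obtain ⟨w, hw⟩ := h
    refine deg_one_case hmin hv (w := w) fun x => ?_
    rw [← mem_neighborSet, hw, Set.mem_singleton_iff]
  · intro h
    unfold deg at h
    rw [Nat.card_coe_set_eq, Set.ncard_eq_two] at h
    obtain ⟨u, w, huw, hw⟩ := h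
    have hN : ∀ x, G.Adj v x ↔ x = u ∨ x = w := fun x => by
      rw [← mem_neighborSet, hw, Set.mem_insert_iff, Set.mem_singleton_iff]
    by_cases hadj : G.Adj u w
    · rcases wt_cases I F u with h1 | h1
      · rcases wt_cases I F w with h2 | h2
        · classical
          have hA := hmin.1.1
          have hpos := (pos_iff G I F U hA).1 hmin.1.2.1
          have hvu : G.Adj v u := (hN u).2 (Or.inl rfl)
          have hvw : G.Adj v w := (hN w).2 (Or.inr rfl)
          have hwv : wt I F v = 4 := by
            have : v ∉ I := fun h => Set.disjoint_left.1 hA.2.1 h hv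
            simp [wt, this, hv]
          have h3 := hpos {v, u, w} (by simp)
          have e1 : adjI G v u = 1 := by simp [adjI, hvu]
          have e2 : adjI G v w = 1 := by simp [adjI, hvw]
          have e3 : adjI G u v = 1 := by simp [adjI, hvu.symm]
          have e4 : adjI G w v = 1 := by simp [adjI, hvw.symm]
          have e5 : adjI G u w = 1 := by simp [adjI, hadj]
          have e6 : adjI G w u = 1 := by simp [adjI, hadj.symm]
          have e7 : ∀ x, adjI G x x = 0 := by simp [adjI]
          have n1 : v ∉ ({u, w} : Finset V) := by simp [hvu.ne, hvw.ne]
          have n2 : u ∉ ({w} : Finset V) := by simp [huw]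
          simp only [pot, dsum, Finset.sum_insert n1, Finset.sum_insert n2,
            Finset.sum_singleton, e1, e2, e3, e4, e5, e6, e7] at h3
          linarith
        · exact deg_two_adj hmin hv hadj.symm (fun x => by rw [hN x, or_comm]) h2
      · exact deg_two_adj hmin hv hadj hN h1
    · exact deg_two_nonadj hmin hv huw hadj hN
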